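/- Let μ ∈ {0,1}^n and S = {i : μ_i = 1}. Then f*_μ(x_1,…,x_n;q,t) = ∏_{i∈S} (x_i − t^{#(S^c ∩ {1,…,i−1})}/t^{n−1}), where S^c is the complement of S in {1,…,n}. Consequently, for 0 ≤ k ≤ n, P*_{(1^k,0^{n−k})}(x_1,…,x_n;q,t) = e*_k(x_1,…,x_n;t); in particular these polynomials do not involve q. -/

import Mathlib

open MvPolynomial

noncomputable section
open scoped Classical

/-- The field `K = ℚ(q,t)`. -/
abbrev K : Type := FractionRing (MvPolynomial (Fin 2) ℚ)

/-- The indeterminate `q` as an element of `K`. -/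
def qq : K := algebraMap (MvPolynomial (Fin 2) ℚ) K (X 0)

/-- The indeterminate `t` as an element of `K`. -/
def tt : K := algebraMap (MvPolynomial (Fin 2) ℚ) K (X 1)

/-- The size `|ν|` of a composition. -/
def csize {n : ℕ} (ν : Fin n → ℕ) : ℕ := ∑ i, ν i

/-- `k_i(ν) = #{j < i : ν_j > ν_i} + #{j > i : ν_j ≥ ν_i}`. -/
def kstat {n : ℕ} (ν : Fin n → ℕ) (i : Fin n) : ℕ :=
  Set.ncard {j : Fin n | j < i ∧ ν i < ν j} + Set.ncard {j : Fin n | i < j ∧ ν i ≤ ν j}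

/-- The evaluation point `ν̃ = (q^{ν_i} t^{-k_i(ν)})_i`. -/
def evalPt {n : ℕ} (ν : Fin n → ℕ) : Fin n → K :=
  fun i => qq ^ ν i * tt ^ (-(kstat ν i : ℤ))

/-- Weakly decreasing composition. -/
def IsPartition {n : ℕ} (l : Fin n → ℕ) : Prop := ∀ i j : Fin n, i ≤ j → l j ≤ l i

/-- The action `σ·μ := μ ∘ σ⁻¹`. -/
def permAct {n : ℕ} (σ : Equiv.Perm (Fin n)) (μ : Fin n → ℕ) : Fin n → ℕ := μ ∘ ⇑σ.symm

/-- `S_n(λ)`: the rearrangements of `λ`. -/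
def Sn {n : ℕ} (l : Fin n → ℕ) : Set (Fin n → ℕ) :=
  {μ | ∃ σ : Equiv.Perm (Fin n), permAct σ l = μ}

/-- The rearrangements of `λ` as a `Finset`. -/
def SnFinset {n : ℕ} (l : Fin n → ℕ) : Finset (Fin n → ℕ) :=
  Finset.image (fun σ : Equiv.Perm (Fin n) => permAct σ l) Finset.univ

/-- The exponent `Finsupp` of the monomial `x^μ`. -/
def expOf {n : ℕ} (μ : Fin n → ℕ) : Fin n →₀ ℕ := Finsupp.equivFunOnFinite.symm μ

/-- Characterization of the interpolation nonsymmetric Macdonald polynomial `E*_μ`. -/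
def IsEstar {n : ℕ} (μ : Fin n → ℕ) (f : MvPolynomial (Fin n) K) : Prop :=
  f.totalDegree ≤ csize μ ∧ coeff (expOf μ) f = 1 ∧
    ∀ ν : Fin n → ℕ, csize ν ≤ csize μ → ν ≠ μ → eval (evalPt ν) f = 0

/-- The interpolation nonsymmetric Macdonald polynomial `E*_μ` (unique by Knop–Sahi). -/
def Estar {n : ℕ} (μ : Fin n → ℕ) : MvPolynomial (Fin n) K :=
  if h : ∃ f, IsEstar μ f then h.choose else 0

/-- Characterization of the interpolation (symmetric) Macdonald polynomial `P*_λ`. -/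
def IsPstar {n : ℕ} (l : Fin n → ℕ) (f : MvPolynomial (Fin n) K) : Prop :=
  f.IsSymmetric ∧ f.totalDegree ≤ csize l ∧ coeff (expOf l) f = 1 ∧
    ∀ ν : Fin n → ℕ, IsPartition ν → csize ν ≤ csize l → ν ≠ l → eval (evalPt ν) f = 0

/-- The interpolation Macdonald polynomial `P*_λ`. -/
def Pstar {n : ℕ} (l : Fin n → ℕ) : MvPolynomial (Fin n) K :=
  if h : ∃ f, IsPstar l f then h.choose else 0

/-- The space `V*_λ`. -/
def Vstar {n : ℕ} (l : Fin n → ℕ) : Submodule K (MvPolynomial (Fin n) K) :=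
  (restrictTotalDegree (Fin n) K (csize l)) ⊓
    ⨅ (ν : Fin n → ℕ) (_ : csize ν ≤ csize l ∧ ν ∉ Sn l),
      LinearMap.ker (aeval (R := K) (evalPt ν)).toLinearMap

/-- Exchange of the variables `x_i` and `x_j` in a polynomial. -/
def swapVars {n : ℕ} (i j : Fin n) (f : MvPolynomial (Fin n) K) : MvPolynomial (Fin n) K :=
  rename (Equiv.swap i j) f

/-- Exact division of polynomials: the unique `g` with `a = b * g` when it exists. -/
def exactDiv {n : ℕ} (a b : MvPolynomial (Fin n) K) : MvPolynomial (Fin n) K :=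
  if h : ∃ g, a = b * g then h.choose else 0

/-- The Hecke operator
`T f = t f − ((t x_i − x_j)/(x_i − x_j))·(f − s_i f)` (where `j = i+1`). -/
def hecke {n : ℕ} (i j : Fin n) (f : MvPolynomial (Fin n) K) : MvPolynomial (Fin n) K :=
  C tt * f - (C tt * X i - X j) * exactDiv (f - swapVars i j f) (X i - X j)

/-- The Coxeter length of a permutation (number of inversions). -/
def permLength {n : ℕ} (σ : Equiv.Perm (Fin n)) : ℕ :=
  Set.ncard {p : Fin n × Fin n | p.1 < p.2 ∧ σ p.2 < σ p.1}

/-- The adjacent transposition `s_i = (i, i+1)` (0-indexed). -/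
def adjSwap {n : ℕ} (i : {i : ℕ // i + 1 < n}) : Equiv.Perm (Fin n) :=
  Equiv.swap ⟨i.1, Nat.lt_of_succ_lt i.2⟩ ⟨i.1 + 1, i.2⟩

/-- The Hecke operator `T_i` for an adjacent transposition index. -/
def heckeAt {n : ℕ} (i : {i : ℕ // i + 1 < n}) :
    MvPolynomial (Fin n) K → MvPolynomial (Fin n) K :=
  hecke ⟨i.1, Nat.lt_of_succ_lt i.2⟩ ⟨i.1 + 1, i.2⟩

/-- `T_{i_1} ⋯ T_{i_ℓ} f` for a word `w = [i_1, …, i_ℓ]`. -/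
def Tword {n : ℕ} (w : List {i : ℕ // i + 1 < n}) (f : MvPolynomial (Fin n) K) :
    MvPolynomial (Fin n) K :=
  w.foldr heckeAt f

/-- `w` is a reduced word for `σ`. -/
def IsReducedWordOf {n : ℕ} (w : List {i : ℕ // i + 1 < n}) (σ : Equiv.Perm (Fin n)) : Prop :=
  (w.map adjSwap).prod = σ ∧ w.length = permLength σ

/-- `T_σ`, computed from a reduced word of `σ` (independent of the choice, by the
Hecke algebra relations). -/
def Tsigma {n : ℕ} (σ : Equiv.Perm (Fin n)) :
    MvPolynomial (Fin n) K → MvPolynomial (Fin n) K :=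
  if h : ∃ w, IsReducedWordOf w σ then Tword h.choose else id

/-- `σ_μ`: the (unique) shortest permutation with `σ·l = μ`. -/
def sigmaMin {n : ℕ} (l μ : Fin n → ℕ) : Equiv.Perm (Fin n) :=
  if h : ∃ σ, permAct σ l = μ ∧ ∀ τ, permAct τ l = μ → permLength σ ≤ permLength τ then
    h.choose else 1

/-- The weakly decreasing rearrangement of a composition. -/
def sortDesc {n : ℕ} (μ : Fin n → ℕ) : Fin n → ℕ :=
  if h : ∃ l, IsPartition l ∧ μ ∈ Sn l then h.choose else μ

/-- The interpolation ASEP polynomial `f*_μ = T_{σ_μ} E*_λ`, where `λ` is the weakly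
decreasing rearrangement of `μ`. -/
def fstar {n : ℕ} (μ : Fin n → ℕ) : MvPolynomial (Fin n) K :=
  Tsigma (sigmaMin (sortDesc μ) μ) (Estar (sortDesc μ))

/-- The composition with entries `i` and `j` exchanged. -/
def swapEntries {n : ℕ} (i j : Fin n) (μ : Fin n → ℕ) : Fin n → ℕ := μ ∘ ⇑(Equiv.swap i j)
/-- The inhomogeneous elementary symmetric polynomial `e*_k(x_1,…,x_n;t)`. -/
def estarElem (n k : ℕ) : MvPolynomial (Fin n) K :=
  ∑ S ∈ Finset.powersetCard k (Finset.univ : Finset (Fin n)),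
    ∏ i ∈ S,
      (X i - C (tt ^ (Finset.univ.filter (fun j : Fin n => j < i ∧ j ∉ S)).card
        / tt ^ (n - 1)))


lemma tt_ne : tt ≠ 0 := by
  unfold tt
  rw [Ne, FaithfulSMul.algebraMap_eq_zero_iff]
  exact X_ne_zero _

lemma qq_ne : qq ≠ 0 := by
  unfold qq
  rw [Ne, FaithfulSMul.algebraMap_eq_zero_iff]
  exact X_ne_zero _

lemma qt_ne (a b c : ℕ) : qq ^ (a + 1) * tt ^ b ≠ tt ^ c := by
  unfold qq tt
  rw [← map_pow, ← map_pow, ← map_pow, ← map_mul]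
  intro h
  have h2 := FaithfulSMul.algebraMap_injective (MvPolynomial (Fin 2) ℚ) K h
  have h3 := congrArg (eval (fun i : Fin 2 => if i = 0 then (0:ℚ) else 1)) h2
  simp at h3

lemma kstat_sum {n : ℕ} (ν : Fin n → ℕ) (i : Fin n) :
    kstat ν i = ∑ j, if (j < i ∧ ν i < ν j) ∨ (i < j ∧ ν i ≤ ν j) then 1 else 0 := by
  unfold kstat
  rw [← Set.ncard_union_eq]
  · rw [Finset.sum_boole, Set.ncard_eq_toFinset_card']
    simp only [Nat.cast_id]
    congr 1
    ext j
    simp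
  · rw [Set.disjoint_left]
    rintro j ⟨h1, _⟩ ⟨h2, _⟩
    exact absurd h1 (not_lt.mpr h2.le)

lemma kstat_cons_zero_zero {n : ℕ} (v : Fin n → ℕ) :
    kstat (Fin.cons 0 v : Fin (n+1) → ℕ) 0 = n := by
  rw [kstat_sum, Fin.sum_univ_succ]
  simp

lemma kstat_cons_zero_succ {n : ℕ} (v : Fin n → ℕ) (i : Fin n) :
    kstat (Fin.cons 0 v : Fin (n+1) → ℕ) i.succ = kstat v i := by
  rw [kstat_sum, kstat_sum, Fin.sum_univ_succ]
  simp

lemma kstat_rot_zero {n : ℕ} (v : Fin n → ℕ) (a : ℕ) :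
    kstat (Fin.cons (a+1) v : Fin (n+1) → ℕ) 0
      = kstat (Fin.snoc v a : Fin (n+1) → ℕ) (Fin.last n) := by
  rw [kstat_sum, kstat_sum, Fin.sum_univ_succ, Fin.sum_univ_castSucc]
  simp [Fin.castSucc_lt_last, Fin.not_lt.mpr (Fin.le_last _)]

lemma kstat_rot_succ {n : ℕ} (v : Fin n → ℕ) (a : ℕ) (i : Fin n) :
    kstat (Fin.cons (a+1) v : Fin (n+1) → ℕ) i.succ
      = kstat (Fin.snoc v a : Fin (n+1) → ℕ) i.castSucc := by
  rw [kstat_sum, kstat_sum, Fin.sum_univ_succ, Fin.sum_univ_castSucc]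
  have : ¬ (Fin.last n < i.castSucc) := Fin.not_lt.mpr (Fin.le_last _)
  simp [Fin.castSucc_lt_last, this, add_comm]

lemma evalPt_cons_zero {n : ℕ} (v : Fin n → ℕ) :
    evalPt (Fin.cons 0 v : Fin (n+1) → ℕ)
      = (Fin.cons (tt ^ (-(n : ℤ))) (evalPt v) : Fin (n+1) → K) := by
  funext i
  refine Fin.cases ?_ (fun j => ?_) i
  · simp [evalPt, kstat_cons_zero_zero]
  · simp [evalPt, kstat_cons_zero_succ]

lemma evalPt_rot {n : ℕ} (v : Fin n → ℕ) (a : ℕ) :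
    evalPt (Fin.cons (a+1) v : Fin (n+1) → ℕ)
      = (Fin.cons (qq * evalPt (Fin.snoc v a : Fin (n+1) → ℕ) (Fin.last n))
          (fun j => evalPt (Fin.snoc v a : Fin (n+1) → ℕ) j.castSucc) : Fin (n+1) → K) := by
  funext i
  refine Fin.cases ?_ (fun j => ?_) i
  · simp [evalPt, kstat_rot_zero]; ring
  · simp [evalPt, kstat_rot_succ]

lemma totalDegree_aeval_le' {n m : ℕ} (g : Fin n → MvPolynomial (Fin m) K)
    (hg : ∀ i, (g i).totalDegree ≤ 1) (f : MvPolynomial (Fin n) K) :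
    (aeval g f).totalDegree ≤ f.totalDegree := by
  rw [aeval_def, eval₂_eq]
  refine totalDegree_finsetSum_le (fun s hs => ?_)
  refine (totalDegree_mul _ _).trans ?_
  rw [algebraMap_eq, totalDegree_C, zero_add]
  refine (totalDegree_finsetProd _ _).trans ?_
  refine le_trans ?_ (le_totalDegree hs)
  rw [Finsupp.sum]
  refine Finset.sum_le_sum (fun i _ => ?_)
  refine (totalDegree_pow _ _).trans ?_
  calc s i * (g i).totalDegree ≤ s i * 1 := Nat.mul_le_mul_left _ (hg i)
    _ = s i := mul_one _

lemma dvd_of_subst {n : ℕ} (c : K) (f : MvPolynomial (Fin (n+1)) K)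
    (h : aeval (Fin.cons (C c) X : Fin (n+1) → MvPolynomial (Fin n) K) f = 0) :
    ∃ g, f = (X 0 - C c) * g := by
  have h1 : Polynomial.eval (C c) (finSuccEquiv K n f) = 0 := by
    rw [← h]
    have : ((Polynomial.aeval (R := MvPolynomial (Fin n) K) (C c)).restrictScalars K).comp
        (finSuccEquiv K n).toAlgHom
        = aeval (Fin.cons (C c) X : Fin (n+1) → MvPolynomial (Fin n) K) := by
      ext1 i
      refine Fin.cases ?_ (fun j => ?_) i
      · simp [finSuccEquiv_X_zero]
      · simp [finSuccEquiv_X_succ]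
    rw [← this]
    simp
  obtain ⟨g, hg⟩ := Polynomial.dvd_iff_isRoot.mpr h1
  refine ⟨(finSuccEquiv K n).symm g, ?_⟩
  apply (finSuccEquiv K n).injective
  rw [hg, map_mul, map_sub, finSuccEquiv_X_zero]
  congr 1
  · simp [finSuccEquiv_apply]
  · simp

theorem interp (n : ℕ) : ∀ (d : ℕ) (f : MvPolynomial (Fin n) K), f.totalDegree ≤ d →
    (∀ ν : Fin n → ℕ, csize ν ≤ d → eval (evalPt ν) f = 0) → f = 0 := by
  induction n with
  | zero =>
    intro d f _ h
    have := h 0 (by simp [csize])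
    rw [eq_C_of_isEmpty f] at this ⊢
    rw [eval_C] at this
    rw [this, C_0]
  | succ n ihn =>
    intro d
    induction d using Nat.strong_induction_on with
    | _ d ihd =>
    intro f hd h
    have h0 : aeval (Fin.cons (C (tt ^ (-(n:ℤ)))) X : Fin (n+1) → MvPolynomial (Fin n) K) f = 0 := by
      apply ihn d
      · refine (totalDegree_aeval_le' _ (fun i => ?_) f).trans hd
        refine Fin.cases ?_ (fun j => ?_) i
        · simp
        · simp
      · intro ν hν
        have := h (Fin.cons 0 ν) (by simpa [csize, Fin.sum_univ_succ] using hν)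
        rw [evalPt_cons_zero] at this
        rw [← this, ← coe_aeval_eq_eval, ← coe_aeval_eq_eval]
        simp only [RingHom.coe_coe]
        rw [comp_aeval_apply]
        congr 2
        funext i
        refine Fin.cases ?_ (fun j => ?_) i <;> simp
    obtain ⟨g, rfl⟩ := dvd_of_subst _ _ h0
    by_cases hg : g = 0
    · simp [hg]
    exfalso
    apply hg
    have hX : (X 0 - C (tt ^ (-(n:ℤ))) : MvPolynomial (Fin (n+1)) K).totalDegree = 1 := by
      rw [sub_eq_add_neg, ← map_neg]
      rw [totalDegree_add_eq_left_of_totalDegree_lt] <;> simp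
    have hX0 : (X 0 - C (tt ^ (-(n:ℤ))) : MvPolynomial (Fin (n+1)) K) ≠ 0 := by
      intro hh; rw [hh] at hX; simp at hX
    rw [totalDegree_mul_of_isDomain hX0 hg, hX] at hd
    have hh : aeval (Fin.cons (C qq * X (Fin.last n)) (fun j => X j.castSucc) :
        Fin (n+1) → MvPolynomial (Fin (n+1)) K) g = 0 := by
      apply ihd (d-1) (by omega)
      · refine (totalDegree_aeval_le' _ (fun i => ?_) g).trans (by omega)
        refine Fin.cases ?_ (fun j => ?_) i
        · refine (totalDegree_mul _ _).trans ?_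
          simp
        · simp
      · intro ν hν
        obtain ⟨v, a, rfl⟩ : ∃ (v : Fin n → ℕ) (a : ℕ), ν = Fin.snoc v a :=
          ⟨Fin.init ν, ν (Fin.last n), by simp⟩
        have := h (Fin.cons (a+1) v) (by
          unfold csize at hν ⊢
          rw [Fin.sum_univ_castSucc] at hν
          rw [Fin.sum_univ_succ]
          simp at hν ⊢; omega)
        rw [eval_mul] at this
        have hne : eval (evalPt (Fin.cons (a+1) v : Fin (n+1) → ℕ)) (X 0 - C (tt ^ (-(n:ℤ)))) ≠ 0 := by
          simp only [map_sub, eval_X, eval_C, evalPt, Fin.cons_zero]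
          rw [sub_ne_zero]
          intro he
          rw [zpow_neg, zpow_neg, zpow_natCast, zpow_natCast] at he
          have := tt_ne
          rw [← div_eq_mul_inv, div_eq_iff (pow_ne_zero _ tt_ne), inv_mul_eq_div,
            eq_div_iff (pow_ne_zero _ tt_ne)] at he
          exact qt_ne _ _ _ he
        have := (mul_eq_zero.mp this).resolve_left hne
        rw [evalPt_rot] at this
        rw [← this, ← coe_aeval_eq_eval, ← coe_aeval_eq_eval]
        simp only [RingHom.coe_coe]
        rw [comp_aeval_apply]
        congr 2
        funext i
        refine Fin.cases ?_ (fun j => ?_) i <;> simp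
    have h2 := congrArg (aeval (Fin.snoc (fun j => X j.succ) (C qq⁻¹ * X 0) :
        Fin (n+1) → MvPolynomial (Fin (n+1)) K)) hh
    rw [map_zero, comp_aeval_apply] at h2
    rw [← h2]
    conv_lhs => rw [← aeval_X_left_apply g]
    congr 2
    funext i
    refine Fin.cases ?_ (fun j => ?_) i
    · simp only [Fin.cons_zero, map_mul, aeval_X, Fin.snoc_last, algHom_C, algebraMap_eq]
      rw [← mul_assoc, ← C_mul, mul_inv_cancel₀ qq_ne, C_1, one_mul]
    · simp

/-- The number of `j` with `j < m` and `p j`. -/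
def cnt {n : ℕ} (p : Fin n → Prop) (m : ℕ) : ℕ :=
  (Finset.univ.filter (fun j : Fin n => (j : ℕ) < m ∧ p j)).card

lemma cnt_succ {n : ℕ} (p : Fin n → Prop) (m : ℕ) (h : m < n) :
    cnt p (m+1) = cnt p m + if p ⟨m, h⟩ then 1 else 0 := by
  unfold cnt
  split_ifs with hp
  · rw [← Finset.card_insert_of_notMem (a := (⟨m, h⟩ : Fin n)) (by simp)]
    congr 1
    ext j
    simp only [Finset.mem_filter, Finset.mem_univ, true_and, Finset.mem_insert]
    constructor
    · rintro ⟨h1, h2⟩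
      rcases Nat.lt_succ_iff_lt_or_eq.mp h1 with h3 | h3
      · exact Or.inr ⟨h3, h2⟩
      · exact Or.inl (Fin.ext h3)
    · rintro (rfl | ⟨h1, h2⟩)
      · exact ⟨Nat.lt_succ_self _, hp⟩
      · exact ⟨by omega, h2⟩
  · rw [add_zero]
    congr 1
    ext j
    simp only [Finset.mem_filter, Finset.mem_univ, true_and]
    constructor
    · rintro ⟨h1, h2⟩
      rcases Nat.lt_succ_iff_lt_or_eq.mp h1 with h3 | h3
      · exact ⟨h3, h2⟩
      · exfalso; apply hp; convert h2; exact h3.symm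
    · rintro ⟨h1, h2⟩
      exact ⟨by omega, h2⟩

lemma cnt_succ_ge {n : ℕ} (p : Fin n → Prop) (m : ℕ) (h : n ≤ m) :
    cnt p (m+1) = cnt p m := by
  unfold cnt
  congr 1
  ext j
  have := j.2
  simp only [Finset.mem_filter, Finset.mem_univ, true_and]
  constructor
  · rintro ⟨h1, h2⟩
    exact ⟨by omega, h2⟩
  · rintro ⟨h1, h2⟩
    exact ⟨by omega, h2⟩

lemma cnt_eq_zero {n : ℕ} (p : Fin n → Prop) (m : ℕ) (h : ∀ j : Fin n, (j : ℕ) < m → ¬ p j) :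
    cnt p m = 0 := by
  unfold cnt
  rw [Finset.card_eq_zero, Finset.filter_eq_empty_iff]
  rintro j _ ⟨hj1, hj2⟩
  exact h j hj1 hj2

lemma cnt_zero {n : ℕ} (p : Fin n → Prop) : cnt p 0 = 0 := by simp [cnt]

lemma cnt_add_not {n : ℕ} (p : Fin n → Prop) (m : ℕ) (h : m ≤ n) :
    cnt p m + cnt (fun j => ¬ p j) m = m := by
  induction m with
  | zero => simp [cnt_zero]
  | succ m ih =>
    rw [cnt_succ _ _ h, cnt_succ _ _ h]
    have := ih (by omega)
    by_cases hp : p ⟨m, h⟩ <;> simp [hp] <;> omega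

lemma kstat_zero {n : ℕ} (ν : Fin n → ℕ) (i : Fin n) (h : ν i = 0) :
    kstat ν i = cnt (fun j => ν j ≠ 0) i + (n - 1 - i) := by
  unfold kstat cnt
  rw [Set.ncard_eq_toFinset_card', Set.ncard_eq_toFinset_card', ← Fin.card_Ioi]
  congr 2
  · ext j
    simp [h, Nat.pos_iff_ne_zero]
  · ext j
    simp [h]

/-- The product attached to a subset `S`. -/
def FS {n : ℕ} (S : Finset (Fin n)) : MvPolynomial (Fin n) K :=
  ∏ i ∈ S, (X i - C (tt ^ (Finset.univ.filter (fun j : Fin n => j < i ∧ j ∉ S)).card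
        / tt ^ (n - 1)))

lemma FS_vanish {n : ℕ} (S : Finset (Fin n)) (ν : Fin n → ℕ) (m : ℕ)
    (h : cnt (fun j => ν j ≠ 0) m < cnt (fun j => j ∈ S) m) :
    eval (evalPt ν) (FS S) = 0 := by
  have hex : ∃ m, cnt (fun j => ν j ≠ 0) m < cnt (fun j => j ∈ S) m := ⟨m, h⟩
  obtain ⟨m0, hm0, hmin⟩ : ∃ m0, cnt (fun j => ν j ≠ 0) m0 < cnt (fun j => j ∈ S) m0 ∧
      ∀ k < m0, ¬ cnt (fun j => ν j ≠ 0) k < cnt (fun j => j ∈ S) k :=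
    ⟨Nat.find hex, Nat.find_spec hex, fun k hk => Nat.find_min hex hk⟩
  cases m0 with
  | zero => simp [cnt_zero] at hm0
  | succ i =>
    have hi := hmin i (Nat.lt_succ_self i)
    by_cases hin : i < n
    swap
    · rw [cnt_succ_ge _ _ (by omega), cnt_succ_ge _ _ (by omega)] at hm0
      exact absurd hm0 hi
    rw [cnt_succ _ _ hin, cnt_succ _ _ hin] at hm0
    by_cases h1 : (⟨i, hin⟩ : Fin n) ∈ S
    swap
    · rw [if_neg h1] at hm0; omega
    rw [if_pos h1] at hm0
    by_cases h2 : ν ⟨i, hin⟩ = 0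
    swap
    · rw [if_pos h2] at hm0; omega
    rw [if_neg (by simpa using h2)] at hm0
    unfold FS
    rw [eval_prod]
    apply Finset.prod_eq_zero h1
    simp only [map_sub, eval_X, eval_C, evalPt, h2, pow_zero, one_mul]
    rw [kstat_zero _ _ h2]
    have h3 := cnt_add_not (fun j => j ∈ S) i hin.le
    have h4 : (Finset.univ.filter (fun j : Fin n => j < ⟨i, hin⟩ ∧ j ∉ S)).card
      = cnt (fun j => ¬ j ∈ S) i := by
      unfold cnt
      congr 1
      ext j
      simp [Fin.lt_def]
    rw [h4, sub_eq_zero, zpow_neg, zpow_natCast, eq_div_iff (pow_ne_zero _ tt_ne),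
      inv_mul_eq_div, div_eq_iff (pow_ne_zero _ tt_ne), ← pow_add]
    congr 1
    simp only
    omega

lemma totalDegree_FS {n : ℕ} (S : Finset (Fin n)) : (FS S).totalDegree ≤ S.card := by
  unfold FS
  refine (totalDegree_finsetProd _ _).trans ?_
  rw [Finset.card_eq_sum_ones]
  refine Finset.sum_le_sum (fun i _ => ?_)
  exact (totalDegree_sub_C_le _ _).trans (by simp)

lemma coeff_prod {n : ℕ} (S V : Finset (Fin n)) (c : Fin n → K) (h : V.card = S.card)
    (e : Fin n →₀ ℕ) (he : ∀ i, e i = if i ∈ V then 1 else 0) :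
    coeff e (∏ i ∈ S, (X i - C (c i) : MvPolynomial (Fin n) K)) = if V = S then 1 else 0 := by
  simp only [sub_eq_add_neg, ← map_neg]
  rw [Finset.prod_add, coeff_sum]
  have key : ∀ U ∈ S.powerset, coeff e ((∏ i ∈ U, X i) * ∏ i ∈ S \ U, (C (-c i)) :
      MvPolynomial (Fin n) K) = if U = S ∧ V = S then 1 else 0 := by
    intro U hU
    rw [Finset.mem_powerset] at hU
    have h1 : (∏ i ∈ U, X i : MvPolynomial (Fin n) K)
        = monomial (∑ i ∈ U, Finsupp.single i 1) 1 := by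
      rw [monomial_sum_one]; rfl
    rw [h1, ← map_prod, mul_comm, coeff_C_mul, coeff_monomial]
    have h2 : (∑ i ∈ U, Finsupp.single i 1 = e) ↔ U = V := by
      constructor
      · intro hh
        ext j
        have := DFunLike.congr_fun hh j
        rw [he] at this
        simp [Finsupp.single_apply] at this
        by_cases hj : j ∈ U <;> by_cases hv : j ∈ V <;> simp_all
      · rintro rfl
        ext j
        rw [he]
        simp [Finsupp.single_apply]
    rw [if_congr h2 rfl rfl]
    by_cases hUV : U = V
    · subst hUV
      have : U = S := Finset.eq_of_subset_of_card_le hU h.ge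
      subst this
      simp
    · rw [if_neg hUV, if_neg, mul_zero]
      rintro ⟨rfl, rfl⟩
      exact hUV rfl
  rw [Finset.sum_congr rfl key]
  by_cases hV : V = S
  · simp [hV]
  · simp [hV]

lemma coeff_FS {n : ℕ} (S V : Finset (Fin n)) (h : V.card = S.card)
    (μ : Fin n → ℕ) (he : ∀ i, μ i = if i ∈ V then 1 else 0) :
    coeff (expOf μ) (FS S) = if V = S then 1 else 0 :=
  coeff_prod S V _ h _ (fun i => by simpa [expOf] using he i)

/-! ### Uniqueness -/

lemma uniq_aux {n : ℕ} (d : ℕ) (μ : Fin n → ℕ) (e : Fin n →₀ ℕ) (f g : MvPolynomial (Fin n) K)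
    (hf : f.totalDegree ≤ d) (hg : g.totalDegree ≤ d)
    (cf : coeff e f = 1) (cg : coeff e g = 1)
    (key : ∀ h : MvPolynomial (Fin n) K, (∃ a b, h = C a * f - C b * g) → h.totalDegree ≤ d →
      eval (evalPt μ) h = 0 → h = 0) : f = g := by
  set a := eval (evalPt μ) f with ha
  set b := eval (evalPt μ) g with hb
  have hfne : a ≠ 0 := by
    intro h0
    have := key f ⟨1, 0, by simp⟩ hf h0
    rw [this] at cf
    simp at cf
  have h1 : C b * f - C a * g = 0 := by
    apply key _ ⟨b, a, rfl⟩
    · refine (totalDegree_sub _ _).trans (max_le ?_ ?_)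
      · exact (totalDegree_mul _ _).trans (by simpa using hf)
      · exact (totalDegree_mul _ _).trans (by simpa using hg)
    · simp only [map_sub, map_mul, eval_C, ← ha, ← hb]
      ring
  have h2 := congrArg (coeff e) h1
  rw [coeff_sub, coeff_C_mul, coeff_C_mul, cf, cg, coeff_zero, mul_one, mul_one, sub_eq_zero] at h2
  rw [h2, ← mul_sub] at h1
  have := (mul_eq_zero.mp h1).resolve_left (by simpa using hfne)
  exact sub_eq_zero.mp this

lemma Estar_eq {n : ℕ} (μ : Fin n → ℕ) (f : MvPolynomial (Fin n) K) (hf : IsEstar μ f) :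
    Estar μ = f := by
  have hex : ∃ f, IsEstar μ f := ⟨f, hf⟩
  unfold Estar
  rw [dif_pos hex]
  have hg := hex.choose_spec
  refine uniq_aux (csize μ) μ (expOf μ) _ _ hg.1 hf.1 hg.2.1 hf.2.1 ?_
  rintro h ⟨a, b, rfl⟩ hd h0
  refine interp n _ _ hd (fun ν hν => ?_)
  by_cases hνμ : ν = μ
  · rw [hνμ, h0]
  · simp [hg.2.2 ν hν hνμ, hf.2.2 ν hν hνμ]

/-- The stable decreasing sort. -/
def dsort {n : ℕ} (ν : Fin n → ℕ) : Equiv.Perm (Fin n) := Tuple.sort (OrderDual.toDual ∘ ν)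

lemma dsort_anti {n : ℕ} (ν : Fin n → ℕ) : IsPartition (ν ∘ dsort ν) := by
  intro i j hij
  have := Tuple.monotone_sort (OrderDual.toDual ∘ ν) hij
  exact this

lemma dsort_stable {n : ℕ} (ν : Fin n → ℕ) (i j : Fin n) (hij : i < j)
    (h : ν (dsort ν i) = ν (dsort ν j)) : dsort ν i < dsort ν j := by
  have := (Tuple.eq_sort_iff (f := OrderDual.toDual ∘ ν) (σ := dsort ν)).mp rfl
  exact this.2 i j hij (by simpa using h)

lemma dsort_stable_iff {n : ℕ} (ν : Fin n → ℕ) (i j : Fin n)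
    (h : ν (dsort ν i) = ν (dsort ν j)) : dsort ν i < dsort ν j ↔ i < j := by
  constructor
  · intro h1
    by_contra h2
    rcases lt_or_eq_of_le (not_lt.mp h2) with h3 | h3
    · exact absurd (dsort_stable ν j i h3 h.symm) (not_lt.mpr h1.le)
    · subst h3; exact lt_irrefl _ h1
  · intro h1; exact dsort_stable ν i j h1 h

lemma kstat_sort {n : ℕ} (ν : Fin n → ℕ) (i : Fin n) :
    kstat (ν ∘ dsort ν) i = kstat ν (dsort ν i) := by
  rw [kstat_sum, kstat_sum]
  conv_rhs => rw [← Equiv.sum_comp (dsort ν)]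
  refine Finset.sum_congr rfl (fun j _ => ?_)
  congr 1
  simp only [Function.comp, eq_iff_iff]
  rcases lt_trichotomy (ν (dsort ν i)) (ν (dsort ν j)) with h | h | h
  · have hne : i ≠ j := by rintro rfl; exact lt_irrefl _ h
    have hne' : dsort ν i ≠ dsort ν j := fun hh => hne ((dsort ν).injective hh)
    simp only [h, h.le, and_true]
    simp [lt_or_lt_iff_ne, hne.symm, hne'.symm]
  · have := dsort_stable_iff ν i j h
    simp [h, this]
  · simp [not_lt.mpr h.le, not_le.mpr h]

lemma evalPt_sort {n : ℕ} (ν : Fin n → ℕ) :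
    evalPt (ν ∘ dsort ν) = evalPt ν ∘ dsort ν := by
  funext i
  simp [evalPt, kstat_sort]

lemma csize_comp {n : ℕ} (ν : Fin n → ℕ) (σ : Equiv.Perm (Fin n)) :
    csize (ν ∘ σ) = csize ν := by
  unfold csize
  exact Equiv.sum_comp σ ν

lemma Pstar_eq {n : ℕ} (μ : Fin n → ℕ) (f : MvPolynomial (Fin n) K)
    (hf : IsPstar μ f) : Pstar μ = f := by
  have hex : ∃ f, IsPstar μ f := ⟨f, hf⟩
  unfold Pstar
  rw [dif_pos hex]
  have hg := hex.choose_spec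
  refine uniq_aux (csize μ) μ (expOf μ) _ _ hg.2.1 hf.2.1 hg.2.2.1 hf.2.2.1 ?_
  rintro h ⟨a, b, hab⟩ hd h0
  have hsym : h.IsSymmetric := by
    intro σ
    rw [hab]
    simp only [map_sub, map_mul, rename_C]
    rw [hg.1 σ, hf.1 σ]
  refine interp n _ _ hd (fun ν hν => ?_)
  have h1 : eval (evalPt (ν ∘ dsort ν)) h = 0 := by
    by_cases hνμ : ν ∘ dsort ν = μ
    · rw [hνμ, h0]
    · have hs : csize (ν ∘ dsort ν) ≤ csize μ := by rw [csize_comp]; exact hν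
      rw [hab]
      simp [hg.2.2.2 _ (dsort_anti ν) hs hνμ, hf.2.2.2 _ (dsort_anti ν) hs hνμ]
  rw [evalPt_sort] at h1
  rw [← hsym (dsort ν), eval_rename]
  exact h1

/-! ### Inversions and words -/

/-- The set of inversions of `f`. -/
def dset {n : ℕ} {α : Type} [LinearOrder α] (f : Fin n → α) : Set (Fin n × Fin n) :=
  {p | p.1 < p.2 ∧ f p.2 < f p.1}

/-- left index -/
def lo {n : ℕ} (i : {i : ℕ // i + 1 < n}) : Fin n := ⟨i.1, Nat.lt_of_succ_lt i.2⟩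
/-- right index -/
def hi {n : ℕ} (i : {i : ℕ // i + 1 < n}) : Fin n := ⟨i.1 + 1, i.2⟩

lemma lo_lt_hi {n : ℕ} (i : {i : ℕ // i + 1 < n}) : lo i < hi i := by
  simp [lo, hi, Fin.lt_def]

lemma lo_ne_hi {n : ℕ} (i : {i : ℕ // i + 1 < n}) : lo i ≠ hi i := (lo_lt_hi i).ne

lemma adjSwap_def {n : ℕ} (i : {i : ℕ // i + 1 < n}) : adjSwap i = Equiv.swap (lo i) (hi i) := rfl

lemma adjSwap_lo {n : ℕ} (i : {i : ℕ // i + 1 < n}) : adjSwap i (lo i) = hi i := by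
  rw [adjSwap_def, Equiv.swap_apply_left]

lemma adjSwap_hi {n : ℕ} (i : {i : ℕ // i + 1 < n}) : adjSwap i (hi i) = lo i := by
  rw [adjSwap_def, Equiv.swap_apply_right]

lemma adjSwap_other {n : ℕ} (i : {i : ℕ // i + 1 < n}) (j : Fin n) (h1 : j ≠ lo i)
    (h2 : j ≠ hi i) : adjSwap i j = j := by
  rw [adjSwap_def, Equiv.swap_apply_of_ne_of_ne h1 h2]

lemma adjSwap_invol {n : ℕ} (i : {i : ℕ // i + 1 < n}) (j : Fin n) :
    adjSwap i (adjSwap i j) = j := by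
  rw [adjSwap_def, Equiv.swap_apply_self]

lemma adjSwap_symm {n : ℕ} (i : {i : ℕ // i + 1 < n}) : (adjSwap i).symm = adjSwap i := by
  rw [adjSwap_def, Equiv.symm_swap]

lemma adjSwap_lt {n : ℕ} (i : {i : ℕ // i + 1 < n}) (a b : Fin n) (hab : a < b)
    (hne : (a, b) ≠ (lo i, hi i)) : adjSwap i a < adjSwap i b := by
  by_cases ha1 : a = lo i
  · have hb1 : b ≠ lo i := by rintro rfl; exact absurd hab (by simp [ha1])
    have hb2 : b ≠ hi i := by rintro rfl; exact hne (by rw [ha1])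
    rw [ha1, adjSwap_lo, adjSwap_other i b hb1 hb2]
    simp only [lo, hi, Fin.lt_def, Fin.ext_iff, ne_eq] at *
    omega
  · by_cases ha2 : a = hi i
    · have hb1 : b ≠ lo i := by
        rintro rfl; exact absurd hab (by rw [ha2]; exact not_lt.mpr (lo_lt_hi i).le)
      have hb2 : b ≠ hi i := by rintro rfl; exact absurd hab (by simp [ha2])
      rw [ha2, adjSwap_hi, adjSwap_other i b hb1 hb2]
      simp only [lo, hi, Fin.lt_def, Fin.ext_iff, ne_eq] at *
      omega
    · rw [adjSwap_other i a ha1 ha2]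
      by_cases hb1 : b = lo i
      · rw [hb1, adjSwap_lo]
        rw [hb1] at hab
        exact hab.trans (lo_lt_hi i)
      · by_cases hb2 : b = hi i
        · rw [hb2, adjSwap_hi]
          simp only [lo, hi, Fin.lt_def, Fin.ext_iff, ne_eq] at *
          omega
        · rwa [adjSwap_other i b hb1 hb2]

lemma dset_image {n : ℕ} {α : Type} [LinearOrder α] (f : Fin n → α) (i : {i : ℕ // i + 1 < n}) :
    (fun p : Fin n × Fin n => (adjSwap i p.1, adjSwap i p.2)) ''
      (dset (f ∘ adjSwap i) \ {(lo i, hi i)}) ⊆ dset f \ {(lo i, hi i)} := by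
  rintro _ ⟨⟨a, b⟩, ⟨⟨h1, h2⟩, h3⟩, rfl⟩
  simp only [Function.comp] at h1 h2
  refine ⟨⟨adjSwap_lt i a b h1 h3, h2⟩, ?_⟩
  intro h
  simp only [Set.mem_singleton_iff, Prod.mk.injEq] at h
  obtain ⟨ha, hb⟩ := h
  have ha' := congrArg (adjSwap i) ha
  have hb' := congrArg (adjSwap i) hb
  rw [adjSwap_invol, adjSwap_lo] at ha'
  rw [adjSwap_invol, adjSwap_hi] at hb'
  rw [ha', hb'] at h1
  exact absurd h1 (not_lt.mpr (lo_lt_hi i).le)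

lemma pair_inj {n : ℕ} (i : {i : ℕ // i + 1 < n}) :
    Function.Injective (fun p : Fin n × Fin n => (adjSwap i p.1, adjSwap i p.2)) := by
  rintro ⟨a, b⟩ ⟨c, d⟩ h
  simpa using h

lemma dset_ncard_le {n : ℕ} {α : Type} [LinearOrder α] (f : Fin n → α)
    (i : {i : ℕ // i + 1 < n}) :
    (dset (f ∘ adjSwap i) \ {(lo i, hi i)}).ncard ≤ (dset f \ {(lo i, hi i)}).ncard := by
  rw [← Set.ncard_image_of_injective _ (pair_inj i)]
  exact Set.ncard_le_ncard (dset_image f i) (Set.toFinite _)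

lemma comp_adj_adj {n : ℕ} {α : Type} (f : Fin n → α) (i : {i : ℕ // i + 1 < n}) :
    (f ∘ adjSwap i) ∘ adjSwap i = f := by
  funext j; simp [adjSwap_invol]

lemma dset_ncard_eq {n : ℕ} {α : Type} [LinearOrder α] (f : Fin n → α)
    (i : {i : ℕ // i + 1 < n}) :
    (dset (f ∘ adjSwap i) \ {(lo i, hi i)}).ncard = (dset f \ {(lo i, hi i)}).ncard := by
  apply le_antisymm (dset_ncard_le f i)
  have := dset_ncard_le (f ∘ adjSwap i) i
  rwa [comp_adj_adj] at this

lemma dset_split {n : ℕ} {α : Type} [LinearOrder α] (f : Fin n → α)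
    (i : {i : ℕ // i + 1 < n}) :
    (dset f).ncard = (dset f \ {(lo i, hi i)}).ncard + if f (hi i) < f (lo i) then 1 else 0 := by
  split_ifs with h
  · exact (Set.ncard_sdiff_singleton_add_one (show (lo i, hi i) ∈ dset f from ⟨lo_lt_hi i, h⟩)
      (Set.toFinite _)).symm
  · rw [Set.sdiff_singleton_eq_self, add_zero]
    exact fun hh => h hh.2

lemma dset_comp {n : ℕ} {α : Type} [LinearOrder α] (f : Fin n → α)
    (i : {i : ℕ // i + 1 < n}) :
    (dset (f ∘ adjSwap i)).ncard + (if f (hi i) < f (lo i) then 1 else 0)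
      = (dset f).ncard + (if f (lo i) < f (hi i) then 1 else 0) := by
  rw [dset_split f i, dset_split (f ∘ adjSwap i) i, dset_ncard_eq]
  simp only [Function.comp, adjSwap_lo, adjSwap_hi]
  omega

lemma permLength_eq {n : ℕ} (σ : Equiv.Perm (Fin n)) : permLength σ = (dset σ).ncard := rfl

lemma exists_descent {n : ℕ} (σ : Equiv.Perm (Fin n)) (h : σ ≠ 1) :
    ∃ i : {i : ℕ // i + 1 < n}, σ (hi i) < σ (lo i) := by
  by_contra hcon
  push Not at hcon
  apply h
  have hmono : Monotone σ := by
    cases n with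
    | zero => intro a; exact a.elim0
    | succ n =>
      rw [Fin.monotone_iff_le_succ]
      intro i
      exact hcon ⟨i.1, by omega⟩
  exact (Equiv.Perm.monotone_iff σ).mp hmono

lemma exists_reduced {n : ℕ} : ∀ (d : ℕ) (σ : Equiv.Perm (Fin n)), permLength σ = d →
    ∃ w, IsReducedWordOf w σ := by
  intro d
  induction d with
  | zero =>
    intro σ hσ
    by_cases h1 : σ = 1
    · exact ⟨[], by simp [h1], by simp [hσ]⟩
    · obtain ⟨i, hi'⟩ := exists_descent σ h1
      have := dset_comp σ i
      rw [permLength_eq] at hσ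
      rw [if_pos hi', if_neg (not_lt.mpr hi'.le)] at this
      omega
  | succ d ih =>
    intro σ hσ
    by_cases h1 : σ = 1
    · exfalso
      rw [permLength_eq, h1] at hσ
      have : dset (⇑(1 : Equiv.Perm (Fin n))) = ∅ := by
        ext p
        simp only [dset, Set.mem_ofPred_eq, Equiv.Perm.coe_one, id, Set.mem_empty_iff_false,
          iff_false, not_and, not_lt]
        exact fun h => h.le
      rw [this] at hσ
      simp at hσ
    · obtain ⟨i, hi'⟩ := exists_descent σ h1
      have := dset_comp σ i
      rw [permLength_eq] at hσ
      rw [if_pos hi', if_neg (not_lt.mpr hi'.le)] at this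
      obtain ⟨w, hw1, hw2⟩ := ih (σ * adjSwap i) (by
        rw [permLength_eq, Equiv.Perm.coe_mul]; omega)
      refine ⟨w ++ [i], ?_, ?_⟩
      · rw [List.map_append, List.prod_append, hw1]
        simp only [List.map_cons, List.map_nil, List.prod_cons, List.prod_nil, mul_one]
        rw [mul_assoc]
        have : adjSwap i * adjSwap i = 1 := by
          rw [adjSwap_def, Equiv.swap_mul_self]
        rw [this, mul_one]
      · rw [List.length_append, hw2]
        rw [permLength_eq, permLength_eq, Equiv.Perm.coe_mul]
        simp only [List.length_cons, List.length_nil]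
        omega

/-! ### The effect of adjacent swaps on the products -/

/-- swapped set -/
def sS {n : ℕ} (i : {i : ℕ // i + 1 < n}) (S : Finset (Fin n)) : Finset (Fin n) :=
  S.image (adjSwap i)

lemma mem_sS {n : ℕ} (i : {i : ℕ // i + 1 < n}) (S : Finset (Fin n)) (j : Fin n) :
    j ∈ sS i S ↔ adjSwap i j ∈ S := by
  unfold sS
  rw [Finset.mem_image]
  constructor
  · rintro ⟨a, ha, rfl⟩
    rwa [adjSwap_invol]
  · intro h
    exact ⟨_, h, adjSwap_invol i j⟩

lemma sS_sS {n : ℕ} (i : {i : ℕ // i + 1 < n}) (S : Finset (Fin n)) : sS i (sS i S) = S := by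
  ext j
  rw [mem_sS, mem_sS, adjSwap_invol]

lemma card_sS {n : ℕ} (i : {i : ℕ // i + 1 < n}) (S : Finset (Fin n)) :
    (sS i S).card = S.card := Finset.card_image_of_injective _ (adjSwap i).injective

/-- exponent -/
def cc {n : ℕ} (S : Finset (Fin n)) (i : Fin n) : ℕ :=
  (Finset.univ.filter (fun j : Fin n => j < i ∧ j ∉ S)).card

lemma FS_def {n : ℕ} (S : Finset (Fin n)) :
    FS S = ∏ i ∈ S, (X i - C (tt ^ cc S i / tt ^ (n-1))) := rfl

lemma adjSwap_lt_iff {n : ℕ} (i : {i : ℕ // i + 1 < n}) (j k : Fin n) (h1 : j ≠ lo i)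
    (h2 : j ≠ hi i) : adjSwap i k < j ↔ k < j := by
  by_cases hk1 : k = lo i
  · rw [hk1, adjSwap_lo]
    simp only [lo, hi, Fin.lt_def, Fin.ext_iff, ne_eq] at *
    omega
  · by_cases hk2 : k = hi i
    · rw [hk2, adjSwap_hi]
      simp only [lo, hi, Fin.lt_def, Fin.ext_iff, ne_eq] at *
      omega
    · rw [adjSwap_other i k hk1 hk2]

lemma cc_sS_other {n : ℕ} (i : {i : ℕ // i + 1 < n}) (S : Finset (Fin n)) (j : Fin n)
    (h1 : j ≠ lo i) (h2 : j ≠ hi i) : cc (sS i S) j = cc S j := by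
  unfold cc
  rw [← Finset.card_image_of_injective _ (adjSwap i).injective]
  congr 1
  ext k
  simp only [Finset.mem_image, Finset.mem_filter, Finset.mem_univ, true_and]
  constructor
  · rintro ⟨a, ⟨ha1, ha2⟩, rfl⟩
    rw [mem_sS] at ha2
    exact ⟨(adjSwap_lt_iff i j a h1 h2).mpr ha1, ha2⟩
  · rintro ⟨ha1, ha2⟩
    refine ⟨adjSwap i k, ⟨(adjSwap_lt_iff i j k h1 h2).mpr ha1, ?_⟩, adjSwap_invol i k⟩
    rwa [mem_sS, adjSwap_invol]

lemma cc_cnt {n : ℕ} (S : Finset (Fin n)) (i : Fin n) : cc S i = cnt (fun j => j ∉ S) i := by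
  unfold cc cnt
  congr 1
  ext j
  simp

lemma cc_hi {n : ℕ} (i : {i : ℕ // i + 1 < n}) (S : Finset (Fin n)) :
    cc S (hi i) = cc S (lo i) + if lo i ∈ S then 0 else 1 := by
  rw [cc_cnt, cc_cnt]
  have := cnt_succ (fun j => j ∉ S) (lo i) (lo i).2
  rw [show ((hi i : Fin n) : ℕ) = (lo i : ℕ) + 1 from rfl, this]
  by_cases h : lo i ∈ S <;> simp [h]

lemma cc_sS_lo {n : ℕ} (i : {i : ℕ // i + 1 < n}) (S : Finset (Fin n)) :
    cc (sS i S) (lo i) = cc S (lo i) := by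
  unfold cc
  congr 1
  ext k
  simp only [Finset.mem_filter, Finset.mem_univ, true_and]
  refine and_congr_right (fun hk => ?_)
  rw [mem_sS, adjSwap_other i k hk.ne (hk.trans (lo_lt_hi i)).ne]

lemma FS_same {n : ℕ} (i : {i : ℕ // i + 1 < n}) (S : Finset (Fin n))
    (h : lo i ∈ S ↔ hi i ∈ S) : rename (adjSwap i) (FS S) = FS S := by
  have hS : sS i S = S := by
    ext j
    rw [mem_sS]
    by_cases h1 : j = lo i
    · rw [h1, adjSwap_lo, h]
    · by_cases h2 : j = hi i
      · rw [h2, adjSwap_hi, h]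
      · rw [adjSwap_other i j h1 h2]
  rw [FS_def, map_prod]
  refine Finset.prod_bij (fun j _ => adjSwap i j) ?_ ?_ ?_ ?_
  · intro j hj
    rw [← hS, mem_sS, adjSwap_invol]; exact hj
  · intro a _ b _ hab
    exact (adjSwap i).injective hab
  · intro b hb
    refine ⟨adjSwap i b, ?_, adjSwap_invol i b⟩
    rw [← mem_sS, hS]; exact hb
  · intro j hj
    rw [map_sub, rename_X, rename_C]
    congr 4
    by_cases h1 : j = lo i
    · rw [h1, adjSwap_lo, cc_hi, if_pos (h1 ▸ hj), add_zero]
    · by_cases h2 : j = hi i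
      · rw [h2, adjSwap_hi, cc_hi, if_pos (h.mpr (h2 ▸ hj)), add_zero]
      · rw [adjSwap_other i j h1 h2]

lemma FS_pair {n : ℕ} (i : {i : ℕ // i + 1 < n}) (S : Finset (Fin n))
    (h1 : lo i ∈ S) (h2 : hi i ∉ S) : ∃ (a : K) (R : MvPolynomial (Fin n) K),
      rename (adjSwap i) R = R ∧ FS S = (X (lo i) - C a) * R ∧
      FS (sS i S) = (X (hi i) - C (tt * a)) * R := by
  refine ⟨tt ^ cc S (lo i) / tt ^ (n-1),
    ∏ j ∈ S.erase (lo i), (X j - C (tt ^ cc S j / tt ^ (n-1))), ?_, ?_, ?_⟩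
  · rw [map_prod]
    refine Finset.prod_congr rfl (fun j hj => ?_)
    rw [Finset.mem_erase] at hj
    rw [map_sub, rename_X, rename_C, adjSwap_other i j hj.1 (fun hh => h2 (hh ▸ hj.2))]
  · rw [FS_def, Finset.mul_prod_erase S (fun j => X j - C (tt ^ cc S j / tt ^ (n-1))) h1]
  · have hS : (sS i S).erase (hi i) = S.erase (lo i) := by
      ext j
      rw [Finset.mem_erase, Finset.mem_erase, mem_sS]
      by_cases h3 : j = lo i
      · simp [h3, adjSwap_lo, h2]
      · by_cases h4 : j = hi i
        · simp [h4, h2]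
        · simp [h3, h4, adjSwap_other i j h3 h4]
    have hmem : hi i ∈ sS i S := by rw [mem_sS, adjSwap_hi]; exact h1
    rw [FS_def, ← Finset.mul_prod_erase _ _ hmem, hS]
    congr 1
    · rw [cc_hi, cc_sS_lo, if_neg (by rw [mem_sS, adjSwap_lo]; exact h2), pow_succ']
      rw [mul_div_assoc]
    · refine Finset.prod_congr rfl (fun j hj => ?_)
      rw [Finset.mem_erase] at hj
      rw [cc_sS_other i S j hj.1 (fun hh => h2 (hh ▸ hj.2))]

lemma hecke_FS {n : ℕ} (i : {i : ℕ // i + 1 < n}) (S : Finset (Fin n))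
    (h1 : lo i ∈ S) (h2 : hi i ∉ S) : heckeAt i (FS S) = FS (sS i S) := by
  obtain ⟨a, R, hR, hS, hS'⟩ := FS_pair i S h1 h2
  have hd : FS S - swapVars (lo i) (hi i) (FS S) = (X (lo i) - X (hi i)) * R := by
    unfold swapVars
    rw [← adjSwap_def, hS, map_mul, hR, map_sub, rename_X, rename_C, adjSwap_lo]
    ring
  have hex : ∃ g, FS S - swapVars (lo i) (hi i) (FS S) = (X (lo i) - X (hi i)) * g := ⟨R, hd⟩
  have hne : (X (lo i) - X (hi i) : MvPolynomial (Fin n) K) ≠ 0 := by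
    rw [sub_ne_zero]
    intro hh
    exact lo_ne_hi i (X_injective hh)
  have hdiv : exactDiv (FS S - swapVars (lo i) (hi i) (FS S)) (X (lo i) - X (hi i)) = R := by
    unfold exactDiv
    rw [dif_pos hex]
    have := hex.choose_spec
    exact (mul_left_cancel₀ hne (hd.symm.trans this)).symm
  change C tt * FS S - (C tt * X (lo i) - X (hi i)) *
    exactDiv (FS S - swapVars (lo i) (hi i) (FS S)) (X (lo i) - X (hi i)) = _
  rw [hdiv, hS, hS', C_mul]
  ring

lemma FS_sum_pair {n : ℕ} (i : {i : ℕ // i + 1 < n}) (S : Finset (Fin n)) :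
    (rename (adjSwap i) (FS S) - FS S) + (rename (adjSwap i) (FS (sS i S)) - FS (sS i S)) = 0 := by
  have main : ∀ S : Finset (Fin n), lo i ∈ S → hi i ∉ S →
    (rename (adjSwap i) (FS S) - FS S)
      + (rename (adjSwap i) (FS (sS i S)) - FS (sS i S)) = 0 := by
    intro S h1 h2
    obtain ⟨a, R, hR, hS, hS'⟩ := FS_pair i S h1 h2
    rw [hS, hS', map_mul, map_mul, hR, map_sub, map_sub, rename_X, rename_X, rename_C, rename_C,
      adjSwap_lo, adjSwap_hi]
    ring
  by_cases h1 : lo i ∈ S <;> by_cases h2 : hi i ∈ S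
  · rw [FS_same i S (by tauto), FS_same i (sS i S) (by
      rw [mem_sS, mem_sS, adjSwap_lo, adjSwap_hi]; tauto)]
    simp
  · exact main S h1 h2
  · have := main (sS i S) (by rwa [mem_sS, adjSwap_lo]) (by rwa [mem_sS, adjSwap_hi])
    rw [sS_sS, add_comm] at this
    exact this
  · rw [FS_same i S (by tauto), FS_same i (sS i S) (by
      rw [mem_sS, mem_sS, adjSwap_lo, adjSwap_hi]; tauto)]
    simp

lemma estar_FS (n k : ℕ) :
    estarElem n k = ∑ S ∈ Finset.powersetCard k (Finset.univ : Finset (Fin n)), FS S := rfl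

lemma estar_adj (n k : ℕ) (i : {i : ℕ // i + 1 < n}) :
    rename (adjSwap i) (estarElem n k) = estarElem n k := by
  rw [estar_FS, map_sum, ← sub_eq_zero, ← Finset.sum_sub_distrib]
  refine Finset.sum_involution (fun S _ => sS i S) ?_ ?_ ?_ ?_
  · intro S _
    exact FS_sum_pair i S
  · intro S _ hne heq
    apply hne
    have := FS_sum_pair i S
    rw [heq, ← two_mul] at this
    exact (mul_eq_zero.mp this).resolve_left two_ne_zero
  · intro S hS
    rw [Finset.mem_powersetCard] at hS ⊢
    exact ⟨Finset.subset_univ _, by rw [card_sS]; exact hS.2⟩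
  · intro S _
    exact sS_sS i S

lemma estar_symm (n k : ℕ) : (estarElem n k).IsSymmetric := by
  intro σ
  obtain ⟨w, hw, hl⟩ := exists_reduced _ σ rfl
  rw [← hw]
  clear hw hl
  induction w with
  | nil => simp
  | cons i w ih =>
    rw [List.map_cons, List.prod_cons, Equiv.Perm.coe_mul, ← rename_rename, ih, estar_adj]

/-! ### Assembly -/

/-- The set of positions where `μ` is one. -/
def So {n : ℕ} (μ : Fin n → ℕ) : Finset (Fin n) := Finset.univ.filter (fun i => μ i = 1)

lemma mem_So {n : ℕ} (μ : Fin n → ℕ) (i : Fin n) : i ∈ So μ ↔ μ i = 1 := by simp [So]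

lemma val_So {n : ℕ} (μ : Fin n → ℕ) (h : ∀ i, μ i ≤ 1) (i : Fin n) :
    μ i = if i ∈ So μ then 1 else 0 := by
  rw [if_congr (mem_So μ i) rfl rfl]
  have := h i
  split_ifs <;> omega

lemma card_So {n : ℕ} (μ : Fin n → ℕ) (h : ∀ i, μ i ≤ 1) : (So μ).card = csize μ := by
  unfold csize
  rw [Finset.sum_congr rfl (fun i _ => val_So μ h i)]
  simp

lemma exists_gap {n : ℕ} (l ν : Fin n → ℕ) (hl : ∀ i, l i ≤ 1) (hs : csize ν ≤ csize l)
    (hne : ν ≠ l) : ∃ i, l i = 1 ∧ ν i = 0 := by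
  by_contra hcon
  push Not at hcon
  have hle : ∀ i ∈ Finset.univ, l i ≤ ν i := by
    intro i _
    have h1 := hl i
    have h2 := hcon i
    by_cases h : l i = 1
    · have := h2 h; omega
    · omega
  have hsum : csize l ≤ csize ν := Finset.sum_le_sum hle
  have heq := (Finset.sum_eq_sum_iff_of_le hle).mp (le_antisymm hsum hs)
  exact hne (funext fun i => (heq i (Finset.mem_univ i)).symm)

lemma isEstar_FS {n : ℕ} (l : Fin n → ℕ) (hp : IsPartition l) (hl : ∀ i, l i ≤ 1) :
    IsEstar l (FS (So l)) := by
  refine ⟨?_, ?_, ?_⟩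
  · rw [← card_So l hl]; exact totalDegree_FS _
  · rw [coeff_FS (So l) (So l) rfl l (val_So l hl), if_pos rfl]
  · intro ν hν hne
    obtain ⟨i, hi1, hi2⟩ := exists_gap l ν hl hν hne
    apply FS_vanish _ _ ((i : ℕ) + 1)
    have h1 := cnt_succ (fun j => ν j ≠ 0) i i.2
    rw [if_neg (by simpa using hi2)] at h1
    have h2 := cnt_add_not (fun j => ν j ≠ 0) i i.2.le
    have h3 := cnt_add_not (fun j => j ∈ So l) (i + 1) i.2
    have h4 : cnt (fun j => ¬ j ∈ So l) (i + 1) = 0 := by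
      apply cnt_eq_zero
      intro j hj1 hj2
      apply hj2
      rw [mem_So]
      have := hp j i (by rw [Fin.le_def]; omega)
      have := hl j
      omega
    omega

lemma permAct_mul {n : ℕ} (i : {i : ℕ // i + 1 < n}) (P : Equiv.Perm (Fin n)) (l : Fin n → ℕ) :
    permAct (adjSwap i * P) l = permAct P l ∘ adjSwap i := by
  funext j
  unfold permAct
  simp only [Function.comp]
  rfl

lemma So_comp {n : ℕ} (i : {i : ℕ // i + 1 < n}) (ρ : Fin n → ℕ) :
    So (ρ ∘ adjSwap i) = sS i (So ρ) := by
  ext j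
  rw [mem_sS, mem_So, mem_So]; rfl

/-- The number of pairs `a < b` with `μ a < μ b`. -/
def inv' {n : ℕ} (μ : Fin n → ℕ) : ℕ := (dset (OrderDual.toDual ∘ μ)).ncard

lemma word_main {n : ℕ} (l : Fin n → ℕ) (hl : ∀ i, l i ≤ 1) (w : List {i : ℕ // i + 1 < n}) :
    inv' (permAct (w.map adjSwap).prod l) ≤ inv' l + w.length ∧
    (inv' (permAct (w.map adjSwap).prod l) = inv' l + w.length →
      Tword w (FS (So l)) = FS (So (permAct (w.map adjSwap).prod l))) := by
  induction w with
  | nil =>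
    have : permAct (1 : Equiv.Perm (Fin n)) l = l := rfl
    simp [this, Tword]
  | cons i w ih =>
    rw [List.map_cons, List.prod_cons, permAct_mul, List.length_cons]
    set ρ := permAct (w.map adjSwap).prod l with hρ
    have hd := dset_comp (OrderDual.toDual ∘ ρ) i
    have hd' : inv' (ρ ∘ adjSwap i) + (if ρ (lo i) < ρ (hi i) then 1 else 0)
        = inv' ρ + (if ρ (hi i) < ρ (lo i) then 1 else 0) := hd
    have hρ1 : ∀ j, ρ j ≤ 1 := fun j => hl _
    constructor
    · split_ifs at hd' <;> omega
    · intro heq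
      have h1 : ρ (hi i) < ρ (lo i) := by
        by_contra hh
        rw [if_neg hh] at hd'
        omega
      rw [if_pos h1, if_neg (not_lt.mpr h1.le)] at hd'
      have h2 := ih.2 (by omega)
      change heckeAt i (Tword w (FS (So l))) = _
      have := hρ1 (lo i)
      rw [h2, So_comp, hecke_FS]
      · rw [mem_So]; omega
      · rw [mem_So]; omega

lemma permAct_dsort {n : ℕ} (μ : Fin n → ℕ) : permAct (dsort μ) (μ ∘ dsort μ) = μ := by
  funext j; simp [permAct]

lemma sortDesc_spec {n : ℕ} (μ : Fin n → ℕ) : IsPartition (sortDesc μ) ∧ μ ∈ Sn (sortDesc μ) := by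
  have hex : ∃ l, IsPartition l ∧ μ ∈ Sn l :=
    ⟨μ ∘ dsort μ, dsort_anti μ, dsort μ, permAct_dsort μ⟩
  unfold sortDesc
  rw [dif_pos hex]
  exact hex.choose_spec

lemma partition_unique {n : ℕ} (l μ : Fin n → ℕ) (hp : IsPartition l) (h : μ ∈ Sn l) :
    μ ∘ dsort μ = l := by
  obtain ⟨σ, hσ⟩ := h
  have h1 : μ ∘ σ = l := by rw [← hσ]; funext j; simp [permAct]
  have h2 : Antitone (μ ∘ σ) := by rw [h1]; exact fun a b hab => hp a b hab
  have h3 : Antitone (μ ∘ dsort μ) := fun a b hab => dsort_anti μ a b hab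
  rw [Tuple.unique_antitone h3 h2, h1]

lemma permLength_dsort {n : ℕ} (μ : Fin n → ℕ) : permLength (dsort μ) ≤ inv' μ := by
  rw [permLength_eq, inv']
  have hinj : Function.Injective
      (fun p : Fin n × Fin n => (dsort μ p.2, dsort μ p.1)) := by
    rintro ⟨a, b⟩ ⟨c, d⟩ h
    simp at h
    simp [h]
  rw [← Set.ncard_image_of_injective _ hinj]
  refine Set.ncard_le_ncard ?_ (Set.toFinite _)
  rintro _ ⟨⟨a, b⟩, ⟨h1, h2⟩, rfl⟩
  refine ⟨h2, ?_⟩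
  change μ (dsort μ b) < μ (dsort μ a)
  have h3 : μ (dsort μ b) ≤ μ (dsort μ a) := dsort_anti μ a b (le_of_lt h1)
  refine lt_of_le_of_ne h3 (fun hh => ?_)
  exact absurd (dsort_stable μ a b h1 hh.symm) (not_lt.mpr (le_of_lt h2))

lemma inv'_partition {n : ℕ} (l : Fin n → ℕ) (hp : IsPartition l) : inv' l = 0 := by
  unfold inv'
  rw [Set.ncard_eq_zero (Set.toFinite _), Set.eq_empty_iff_forall_notMem]
  rintro ⟨a, b⟩ ⟨h1, h2⟩
  exact absurd (hp a b (le_of_lt h1)) (not_le.mpr h2)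

lemma sigmaMin_spec {n : ℕ} (l μ : Fin n → ℕ) (h : μ ∈ Sn l) :
    permAct (sigmaMin l μ) l = μ ∧
      ∀ τ, permAct τ l = μ → permLength (sigmaMin l μ) ≤ permLength τ := by
  have hex : ∃ σ, permAct σ l = μ ∧ ∀ τ, permAct τ l = μ → permLength σ ≤ permLength τ := by
    obtain ⟨σ, hσ, hm⟩ := Set.exists_min_image {σ : Equiv.Perm (Fin n) | permAct σ l = μ}
      permLength (Set.toFinite _) h
    exact ⟨σ, hσ, hm⟩
  unfold sigmaMin
  rw [dif_pos hex]
  exact hex.choose_spec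

lemma fstar_FS {n : ℕ} (μ : Fin n → ℕ) (hμ : ∀ i, μ i ≤ 1) : fstar μ = FS (So μ) := by
  unfold fstar
  obtain ⟨hp, hSn⟩ := sortDesc_spec μ
  have hs := partition_unique _ _ hp hSn
  set l := sortDesc μ with hl
  have hl1 : ∀ i, l i ≤ 1 := fun i => by rw [← hs]; exact hμ _
  rw [Estar_eq l _ (isEstar_FS l hp hl1)]
  obtain ⟨h1, h2⟩ := sigmaMin_spec l μ hSn
  have hex := exists_reduced _ (sigmaMin l μ) rfl
  unfold Tsigma
  rw [dif_pos hex]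
  obtain ⟨hw1, hw2⟩ := hex.choose_spec
  obtain ⟨hm1, hm2⟩ := word_main l hl1 hex.choose
  rw [hw1, h1] at hm1 hm2
  apply hm2
  have h3 := h2 (dsort μ) (by rw [← hs]; exact permAct_dsort μ)
  have h4 := permLength_dsort μ
  rw [inv'_partition l hp] at hm1 ⊢
  omega

lemma isPstar_estar (n k : ℕ) (hk : k ≤ n) :
    IsPstar (fun i : Fin n => if (i : ℕ) < k then 1 else 0) (estarElem n k) := by
  set l : Fin n → ℕ := fun i : Fin n => if (i : ℕ) < k then 1 else 0 with hl
  have hl1 : ∀ i, l i ≤ 1 := by intro i; simp only [hl]; split_ifs <;> omega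
  have hcard : (So l).card = k := by
    have h0 : (So l).card = cnt (fun _ : Fin n => True) k := by
      unfold cnt So
      congr 1
      ext j
      simp [hl]
    have := cnt_add_not (fun _ : Fin n => True) k hk
    have h2 : cnt (fun _ : Fin n => ¬ True) k = 0 := by simp [cnt]
    omega
  have hsize : csize l = k := by rw [← card_So l hl1, hcard]
  refine ⟨estar_symm n k, ?_, ?_, ?_⟩
  · rw [estar_FS, hsize]
    refine totalDegree_finsetSum_le (fun S hS => ?_)
    rw [Finset.mem_powersetCard] at hS
    rw [← hS.2]; exact totalDegree_FS S
  · rw [estar_FS, coeff_sum]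
    have : ∀ S ∈ Finset.powersetCard k (Finset.univ : Finset (Fin n)),
        coeff (expOf l) (FS S) = if So l = S then 1 else 0 := by
      intro S hS
      rw [Finset.mem_powersetCard] at hS
      exact coeff_FS S (So l) (by rw [hcard, hS.2]) l (val_So l hl1)
    rw [Finset.sum_congr rfl this, Finset.sum_ite_eq, if_pos]
    rw [Finset.mem_powersetCard]
    exact ⟨Finset.subset_univ _, hcard⟩
  · intro ν hν hs hne
    obtain ⟨i, hi1, hi2⟩ := exists_gap l ν hl1 hs hne
    have hik : (i : ℕ) < k := by
      by_contra hh
      simp [hl, hh] at hi1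
    rw [estar_FS, map_sum]
    refine Finset.sum_eq_zero (fun S hS => ?_)
    rw [Finset.mem_powersetCard] at hS
    apply FS_vanish S ν n
    have h1 : cnt (fun j => j ∈ S) n = k := by
      rw [← hS.2]
      unfold cnt
      congr 1
      ext j
      simp
    have h2 : cnt (fun j => ν j ≠ 0) n = cnt (fun j => ν j ≠ 0) i := by
      unfold cnt
      congr 1
      ext j
      simp only [Finset.mem_filter, Finset.mem_univ, true_and, j.2]
      refine ⟨fun h => ⟨?_, h⟩, fun h => h.2⟩
      by_contra hh
      have := hν i j (by rw [Fin.le_def]; omega)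
      omega
    have h3 := cnt_add_not (fun j => ν j ≠ 0) i i.2.le
    omega

/-- factorization of `f*_μ` for `μ ∈ {0,1}^n`, and
`P*_{(1^k, 0^{n−k})} = e*_k`. -/
theorem statement16 (n : ℕ) (hn : 1 ≤ n) :
    (∀ μ : Fin n → ℕ, (∀ i, μ i ≤ 1) →
      fstar μ = ∏ i ∈ Finset.univ.filter (fun i : Fin n => μ i = 1),
        (X i - C (tt ^ (Finset.univ.filter (fun j : Fin n => j < i ∧ μ j = 0)).card
          / tt ^ (n - 1)))) ∧
    (∀ k : ℕ, k ≤ n →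
      Pstar (fun i : Fin n => if (i : ℕ) < k then 1 else 0) = estarElem n k) := by
  refine ⟨fun μ hμ => ?_, fun k hk => Pstar_eq _ _ (isPstar_estar n k hk)⟩
  rw [fstar_FS μ hμ]
  unfold FS So
  refine Finset.prod_congr rfl (fun i _ => ?_)
  congr 5
  ext j
  have := hμ j
  simp only [Finset.mem_filter, Finset.mem_univ, true_and]
  refine and_congr_right (fun _ => ?_)
  omega
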